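/- arXiv:1012.0230 — 4 statements merged into one kernel-verified Lean document; each statement's English description precedes it below -/
import Mathlib

section
/- Let g ≥ 0 and c ≥ 1 be real numbers, and let T : ℕ → ℝ be a function with T(0) = 0 such that for every n ≥ 1 there exist natural numbers n₁, n₂, n₃ with n = n₁ + n₂ + n₃ + 1, n₂ ≤ n₁, n₂ ≤ n₃, and T(n) ≤ T(n₁) + T(n₂) + T(n₃) + c · n₂ · g. Then for every natural number n, T(n) ≤ c · g · n · log₂ n (where n · log₂ n is interpreted as 0 for n = 0). -/
theorem natCast_mul_logb_two_le (k : ℕ) {x : ℝ} (h : (k : ℝ) ≤ x) :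
    (k : ℝ) * Real.logb 2 k ≤ k * Real.logb 2 x := by
  rcases Nat.eq_zero_or_pos k with rfl | hk
  · simp
  · have hk' : (0 : ℝ) < k := by exact_mod_cast hk
    exact mul_le_mul_of_nonneg_left
      (Real.logb_le_logb_of_le one_lt_two hk' h) hk'.le

/-- Superadditivity of `x * log₂ x`, with a gain of any part dominated by another one. -/
theorem mul_logb_two_add_le_of_le (a b d : ℕ) (hba : b ≤ a) :
    (a : ℝ) * Real.logb 2 a + b * Real.logb 2 b + d * Real.logb 2 d + b ≤
      ((a + b + d + 1 : ℕ) : ℝ) * Real.logb 2 ((a + b + d + 1 : ℕ) : ℝ) := by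
  set N : ℝ := ((a + b + d + 1 : ℕ) : ℝ) with hN
  have hNe : N = a + b + d + 1 := by rw [hN]; push_cast; ring
  have ha : (0 : ℝ) ≤ a := a.cast_nonneg
  have hb : (0 : ℝ) ≤ b := b.cast_nonneg
  have hd : (0 : ℝ) ≤ d := d.cast_nonneg
  have hba' : (b : ℝ) ≤ a := by exact_mod_cast hba
  have h₁ := natCast_mul_logb_two_le a (x := N) (by linarith)
  have h₂ := natCast_mul_logb_two_le b (x := N / 2) (by linarith)
  have h₃ := natCast_mul_logb_two_le d (x := N) (by linarith)
  have hlog : 0 ≤ Real.logb 2 N := Real.logb_nonneg one_lt_two (by linarith)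
  rw [Real.logb_div (by linarith) two_ne_zero,
    Real.logb_self_eq_one one_lt_two] at h₂
  have hsplit : N * Real.logb 2 N =
      a * Real.logb 2 N + b * Real.logb 2 N + d * Real.logb 2 N + Real.logb 2 N := by
    nth_rewrite 1 [hNe]
    ring
  linarith

/-- The divide-and-conquer recurrence: if `T 0 = 0` and for every `n ≥ 1` there are
`n₁, n₂, n₃` with `n = n₁ + n₂ + n₃ + 1`, `n₂ ≤ n₁`, `n₂ ≤ n₃` and
`T n ≤ T n₁ + T n₂ + T n₃ + c * n₂ * g`, then `T n ≤ c * g * n * log₂ n`. -/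
theorem stmt0 (g c : ℝ) (hg : 0 ≤ g) (hc : 1 ≤ c) (T : ℕ → ℝ) (hT0 : T 0 = 0)
    (hrec : ∀ n : ℕ, 1 ≤ n → ∃ n₁ n₂ n₃ : ℕ,
      n = n₁ + n₂ + n₃ + 1 ∧ n₂ ≤ n₁ ∧ n₂ ≤ n₃ ∧
      T n ≤ T n₁ + T n₂ + T n₃ + c * (n₂ : ℝ) * g) :
    ∀ n : ℕ, T n ≤ c * g * (n : ℝ) * Real.logb 2 (n : ℝ) := by
  intro n
  induction n using Nat.strong_induction_on with
  | _ n ih =>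
    rcases Nat.eq_zero_or_pos n with rfl | hn
    · simp [hT0]
    · obtain ⟨a, b, d, rfl, hba, -, hT⟩ := hrec n hn
      have h₁ := ih a (by omega)
      have h₂ := ih b (by omega)
      have h₃ := ih d (by omega)
      have hcg : 0 ≤ c * g := mul_nonneg (by linarith) hg
      have hmul := mul_le_mul_of_nonneg_left (mul_logb_two_add_le_of_le a b d hba) hcg
      linarith
end

section
/- Let x, y, z ∈ ℝ² be affinely independent, and let S be a finite set of points contained in the open triangle △xyz, such that the set S ∪ {x, y, z} is in general position. Let n₁, n₂, n₃ be natural numbers with n₁ + n₂ + n₃ = |S| − 1. If u ∈ S and u' ∈ S both satisfy the three conditions N_S(△x·y) = n₁, N_S(△y·z) = n₂, N_S(△z·x) = n₃ (with the candidate point in the middle slot), then u = u'. -/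
open scoped Classical

/-- Number of points of `S` strictly inside the triangle with vertices `a`, `b`, `c`
(the interior of the convex hull of `{a, b, c}`). -/
noncomputable def NTri (S : Finset (ℝ × ℝ)) (a b c : ℝ × ℝ) : ℕ :=
  (S.filter (fun p => p ∈ interior (convexHull ℝ ({a, b, c} : Set (ℝ × ℝ))))).card

/-- A set of points in the plane is in general position if no three distinct
points of it are collinear. -/
def GenPos (P : Set (ℝ × ℝ)) : Prop :=
  ∀ p ∈ P, ∀ q ∈ P, ∀ r ∈ P,
    p ≠ q → p ≠ r → q ≠ r → ¬ Collinear ℝ ({p, q, r} : Set (ℝ × ℝ))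

theorem AffineIndependent.exists_affineBasis_triangle {a b c : ℝ × ℝ}
    (h : AffineIndependent ℝ ![a, b, c]) :
    ∃ B : AffineBasis (Fin 3) ℝ (ℝ × ℝ), ⇑B = ![a, b, c] :=
  ⟨⟨![a, b, c], h, h.affineSpan_eq_top_iff_card_eq_finrank_add_one.2 (by simp)⟩, rfl⟩

theorem AffineBasis.interior_convexHull_triangle {a b c : ℝ × ℝ}
    {B : AffineBasis (Fin 3) ℝ (ℝ × ℝ)} (hB : ⇑B = ![a, b, c]) :
    interior (convexHull ℝ ({a, b, c} : Set (ℝ × ℝ))) = {p | ∀ i, 0 < B.coord i p} := by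
  rw [← B.interior_convexHull, hB]
  congr 2
  simp only [Matrix.range_cons, Matrix.range_empty, Set.union_empty]
  rfl

theorem mem_interior_triangle_iff {a b c : ℝ × ℝ} (h : AffineIndependent ℝ ![a, b, c])
    (p : ℝ × ℝ) :
    p ∈ interior (convexHull ℝ ({a, b, c} : Set (ℝ × ℝ))) ↔
      ∃ α β γ : ℝ, 0 < α ∧ 0 < β ∧ 0 < γ ∧ α + β + γ = 1 ∧ p = α • a + β • b + γ • c := by
  obtain ⟨B, hB⟩ := h.exists_affineBasis_triangle
  rw [B.interior_convexHull_triangle hB]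
  constructor
  · intro hp
    have hsum := B.sum_coord_apply_eq_one p
    have hlin := B.linear_combination_coord_eq_self p
    rw [Fin.sum_univ_three] at hsum hlin
    simp only [hB] at hlin
    exact ⟨_, _, _, hp 0, hp 1, hp 2, hsum, by simpa using hlin.symm⟩
  · rintro ⟨α, β, γ, hα, hβ, hγ, hsum, rfl⟩ i
    have hw : ∑ i, ![α, β, γ] i = 1 := by simpa [Fin.sum_univ_three] using hsum
    have := B.coord_apply_combination_of_mem (Finset.mem_univ i) hw
    rw [Finset.affineCombination_eq_linear_combination _ _ _ hw, Fin.sum_univ_three, hB] at this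
    simp only [Matrix.cons_val] at this
    rw [this]
    fin_cases i <;> assumption

theorem vertex_notMem_interior_triangle {a b c q : ℝ × ℝ} (h : AffineIndependent ℝ ![a, b, c])
    (hq : q ∈ ({a, b, c} : Set (ℝ × ℝ))) :
    q ∉ interior (convexHull ℝ ({a, b, c} : Set (ℝ × ℝ))) := by
  obtain ⟨B, hB⟩ := h.exists_affineBasis_triangle
  rw [B.interior_convexHull_triangle hB]
  intro hp
  obtain ⟨i, rfl⟩ : ∃ i, B i = q := by
    rw [hB]
    rcases hq with rfl | rfl | rfl
    exacts [⟨0, rfl⟩, ⟨1, rfl⟩, ⟨2, rfl⟩]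
  obtain ⟨j, hj⟩ := exists_ne i
  exact (hp j).ne' (B.coord_apply_ne hj)

theorem ne_zero_of_not_collinear {a b c : ℝ × ℝ} {α β γ : ℝ}
    (hsum : α + β + γ = 1)
    {p : ℝ × ℝ} (hp : p = α • a + β • b + γ • c)
    (hcol : ¬ Collinear ℝ ({p, a, b} : Set (ℝ × ℝ))) : γ ≠ 0 := by
  rintro rfl
  refine hcol (collinear_insert_of_mem_affineSpan_pair ?_)
  have : p = AffineMap.lineMap a b β := by
    rw [hp, AffineMap.lineMap_apply_module, show α = 1 - β by linarith]
    simp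
  exact this ▸ AffineMap.lineMap_mem_affineSpan_pair β a b

/-- If the barycentric coordinate ratio of `v` to `u` is smallest at the vertex `z`, then `v` lies
in the triangle obtained by replacing `z` with `u`. -/
theorem mem_interior_subtriangle {x y z u v : ℝ × ℝ} {α β γ α' β' γ' : ℝ}
    (hγ : 0 < γ) (hγ' : 0 < γ')
    (hsum : α + β + γ = 1) (hsum' : α' + β' + γ' = 1)
    (hu : u = α • x + β • y + γ • z) (hv : v = α' • x + β' • y + γ' • z)
    (hα : γ' / γ ≤ α' / α) (hβ : γ' / γ ≤ β' / β) (hα0 : 0 < α) (hβ0 : 0 < β)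
    (hxuy : ¬ Collinear ℝ ({x, u, y} : Set (ℝ × ℝ)))
    (hvux : ¬ Collinear ℝ ({v, u, x} : Set (ℝ × ℝ)))
    (hvuy : ¬ Collinear ℝ ({v, u, y} : Set (ℝ × ℝ))) :
    v ∈ interior (convexHull ℝ ({x, u, y} : Set (ℝ × ℝ))) := by
  rw [mem_interior_triangle_iff (affineIndependent_iff_not_collinear_set.2 hxuy)]
  obtain ⟨t, ht⟩ : ∃ t, t = γ' / γ := ⟨_, rfl⟩
  have ht0 : 0 < t := ht ▸ div_pos hγ' hγ
  have htγ : t * γ = γ' := (eq_div_iff hγ.ne').1 ht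
  rw [← ht] at hα hβ
  rw [le_div_iff₀ hα0] at hα
  rw [le_div_iff₀ hβ0] at hβ
  have hs : (α' - t * α) + t + (β' - t * β) = 1 := by
    linear_combination hsum' - t * hsum + htγ
  have hcomb : v = (α' - t * α) • x + t • u + (β' - t * β) • y := by
    rw [hv, hu, ← htγ]
    module
  refine ⟨α' - t * α, t, β' - t * β, ?_, ht0, ?_, hs, hcomb⟩
  · refine lt_of_le_of_ne (by linarith) (Ne.symm ?_)
    exact ne_zero_of_not_collinear (a := u) (b := y) (c := x) (α := t) (β := β' - t * β) (by linarith)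
      (hcomb.trans (by module)) hvuy
  · refine lt_of_le_of_ne (by linarith) (Ne.symm ?_)
    exact ne_zero_of_not_collinear (a := u) (b := x) (c := y) (α := t) (β := α' - t * α) (by linarith)
      (hcomb.trans (by module)) hvux

theorem NTri_lt_of_mem_interior {S : Finset (ℝ × ℝ)} {x y u v : ℝ × ℝ} (hvS : v ∈ S)
    (hxvy : ¬ Collinear ℝ ({x, v, y} : Set (ℝ × ℝ)))
    (hv : v ∈ interior (convexHull ℝ ({x, u, y} : Set (ℝ × ℝ)))) :
    NTri S x v y < NTri S x u y := by
  have hsub : convexHull ℝ ({x, v, y} : Set (ℝ × ℝ)) ⊆ convexHull ℝ {x, u, y} := by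
    refine convexHull_min ?_ (convex_convexHull ℝ _)
    rintro _ (rfl | rfl | rfl)
    exacts [subset_convexHull ℝ _ (by simp), interior_subset hv, subset_convexHull ℝ _ (by simp)]
  refine Finset.card_lt_card (Finset.ssubset_iff_of_subset ?_ |>.2 ⟨v, by simp [hvS, hv], ?_⟩)
  · exact Finset.monotone_filter_right _ fun p _ hp => interior_mono hsub hp
  · rw [Finset.mem_filter]
    exact fun h => vertex_notMem_interior_triangle
      (affineIndependent_iff_not_collinear_set.2 hxvy) (by simp) h.2

theorem le_and_le_cyclic {R : Type*} [LinearOrder R] (a b c : R) :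
    (c ≤ a ∧ c ≤ b) ∨ (a ≤ b ∧ a ≤ c) ∨ (b ≤ c ∧ b ≤ a) := by
  grind

/-- Uniqueness of the point splitting the interior points of a triangle into
prescribed counts. -/
theorem stmt1 (x y z : ℝ × ℝ) (hxyz : AffineIndependent ℝ ![x, y, z])
    (S : Finset (ℝ × ℝ))
    (hS : ∀ p ∈ S, p ∈ interior (convexHull ℝ ({x, y, z} : Set (ℝ × ℝ))))
    (hgp : GenPos ((S : Set (ℝ × ℝ)) ∪ {x, y, z}))
    (n₁ n₂ n₃ : ℕ) (hn : n₁ + n₂ + n₃ = S.card - 1)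
    (u u' : ℝ × ℝ) (hu : u ∈ S) (hu' : u' ∈ S)
    (h1 : NTri S x u y = n₁) (h2 : NTri S y u z = n₂) (h3 : NTri S z u x = n₃)
    (h1' : NTri S x u' y = n₁) (h2' : NTri S y u' z = n₂) (h3' : NTri S z u' x = n₃) :
    u = u' := by
  by_contra hne
  have hxy : x ≠ y := fun h => by simpa using hxyz.injective (a₁ := 0) (a₂ := 1) h
  have hyz : y ≠ z := fun h => by simpa using hxyz.injective (a₁ := 1) (a₂ := 2) h
  have hzx : z ≠ x := fun h => by simpa using hxyz.injective (a₁ := 2) (a₂ := 0) h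
  have hvertex : ∀ p ∈ S, ∀ q ∈ ({x, y, z} : Set (ℝ × ℝ)), p ≠ q := by
    rintro p hp q hq rfl
    exact vertex_notMem_interior_triangle hxyz hq (hS p hp)
  have hside : ∀ p ∈ S, ∀ q ∈ ({x, y, z} : Set (ℝ × ℝ)), ∀ r ∈ ({x, y, z} : Set (ℝ × ℝ)),
      q ≠ r → ¬ Collinear ℝ ({q, p, r} : Set (ℝ × ℝ)) := fun p hp q hq r hr hqr =>
    hgp q (.inr hq) p (.inl hp) r (.inr hr) (hvertex p hp q hq).symm hqr (hvertex p hp r hr)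
  have hpair : ∀ q ∈ ({x, y, z} : Set (ℝ × ℝ)),
      ¬ Collinear ℝ ({u', u, q} : Set (ℝ × ℝ)) := fun q hq =>
    hgp u' (.inl hu') u (.inl hu) q (.inr hq) (Ne.symm hne) (hvertex u' hu' q hq)
      (hvertex u hu q hq)
  have hx : x ∈ ({x, y, z} : Set (ℝ × ℝ)) := by simp
  have hy : y ∈ ({x, y, z} : Set (ℝ × ℝ)) := by simp
  have hz : z ∈ ({x, y, z} : Set (ℝ × ℝ)) := by simp
  obtain ⟨α, β, γ, hα, hβ, hγ, hs, hcomb⟩ := (mem_interior_triangle_iff hxyz u).1 (hS u hu)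
  obtain ⟨α', β', γ', hα', hβ', hγ', hs', hcomb'⟩ :=
    (mem_interior_triangle_iff hxyz u').1 (hS u' hu')
  rcases le_and_le_cyclic (α' / α) (β' / β) (γ' / γ) with ⟨h, k⟩ | ⟨h, k⟩ | ⟨h, k⟩
  · have := NTri_lt_of_mem_interior hu' (hside u' hu' x hx y hy hxy)
      (mem_interior_subtriangle hγ hγ' hs hs' hcomb hcomb' h k hα hβ
        (hside u hu x hx y hy hxy) (hpair x hx) (hpair y hy))
    omega
  · have := NTri_lt_of_mem_interior hu' (hside u' hu' y hy z hz hyz)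
      (mem_interior_subtriangle (z := x) hα hα' (by linarith) (by linarith)
        (hcomb.trans (by module)) (hcomb'.trans (by module)) h k hβ hγ
        (hside u hu y hy z hz hyz) (hpair y hy) (hpair z hz))
    omega
  · have := NTri_lt_of_mem_interior hu' (hside u' hu' z hz x hx hzx)
      (mem_interior_subtriangle (z := y) hβ hβ' (by linarith) (by linarith)
        (hcomb.trans (by module)) (hcomb'.trans (by module)) h k hγ hα
        (hside u hu z hz x hx hzx) (hpair z hz) (hpair x hx))
    omega
end

section
/- Let x, y ∈ ℝ², let v ∈ ℝ² be such that x, v, y are affinely independent, let S be a finite set of points of ℝ², and let u ∈ S be a point in the open triangle △xvy. Then N_S(△xuy) ≤ N_S(△xvy) − 1; in particular N_S(△xuy) < N_S(△xvy). -/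
open scoped Classical

/-- A vertex of a planar triangle is not an interior point of the triangle. -/
theorem vertex_notMem_interior_convexHull (a b c : ℝ × ℝ) :
    b ∉ interior (convexHull ℝ ({a, b, c} : Set (ℝ × ℝ))) := by
  intro hb
  have hrange : Set.range ![a, b, c] = {a, b, c} := by
    simp only [Matrix.range_cons, Matrix.range_empty, Set.union_empty, Set.singleton_union]
  have hspan : affineSpan ℝ (Set.range ![a, b, c]) = ⊤ := by
    rw [hrange]
    exact interior_convexHull_nonempty_iff_affineSpan_eq_top.mp ⟨b, hb⟩
  have hind : AffineIndependent ℝ ![a, b, c] := by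
    rw [affineIndependent_iff_finrank_vectorSpan_eq ℝ _ (n := 2) (by simp),
      ← direction_affineSpan, hspan, AffineSubspace.direction_top, finrank_top]
    simp
  let B : AffineBasis (Fin 3) ℝ (ℝ × ℝ) := ⟨![a, b, c], hind, hspan⟩
  have hB : b ∈ interior (convexHull ℝ (Set.range B)) := by
    rw [← hrange] at hb
    exact hb
  rw [B.interior_convexHull] at hB
  have hpos : 0 < B.coord 0 (B 1) := hB 0
  rw [B.coord_apply_ne (by decide)] at hpos
  exact lt_irrefl _ hpos

/-- Exclusion argument: if `u ∈ S` lies strictly inside `△xvy`, then the count of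
points of `S` strictly inside `△xuy` is strictly smaller than that inside `△xvy`. -/
theorem stmt6 (x y v : ℝ × ℝ) (hxvy : AffineIndependent ℝ ![x, v, y])
    (S : Finset (ℝ × ℝ)) (u : ℝ × ℝ) (hu : u ∈ S)
    (huin : u ∈ interior (convexHull ℝ ({x, v, y} : Set (ℝ × ℝ)))) :
    NTri S x u y ≤ NTri S x v y - 1 ∧ NTri S x u y < NTri S x v y := by
  have hsub : convexHull ℝ ({x, u, y} : Set (ℝ × ℝ)) ⊆ convexHull ℝ {x, v, y} := by
    refine convexHull_min ?_ (convex_convexHull ℝ _)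
    rintro p (rfl | rfl | rfl)
    · exact subset_convexHull ℝ _ (by simp)
    · exact interior_subset huin
    · exact subset_convexHull ℝ _ (by simp)
  have hlt : NTri S x u y < NTri S x v y := by
    refine Finset.card_lt_card ((Finset.ssubset_iff_of_subset ?_).mpr ⟨u, ?_, ?_⟩)
    · exact Finset.monotone_filter_right S fun p _ hp => interior_mono hsub hp
    · exact Finset.mem_filter.mpr ⟨hu, huin⟩
    · exact fun h => vertex_notMem_interior_convexHull x u y (Finset.mem_filter.mp h).2
  exact ⟨Nat.le_sub_one_of_lt hlt, hlt⟩
end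

section
/- Let N be a positive integer and let a, b, c, d ∈ ℤ² be points all of whose coordinates have absolute value at most N, such that the direction vectors b − a and d − c are not parallel (their 2×2 determinant (b−a)₁(d−c)₂ − (b−a)₂(d−c)₁ is nonzero). Let u ∈ ℝ² be a point lying both on the affine line through a and b and on the affine line through c and d (with the integer points regarded as points of ℝ²). Then there exists a nonzero integer D with |D| ≤ 8N² such that both coordinates of D · u are integers. -/
/-- Four integers of absolute value at most `M` have `2 × 2` determinant at most `2M²` in
absolute value. -/
theorem abs_det_two_le {M x y z w : ℤ} (hx : |x| ≤ M) (hy : |y| ≤ M) (hz : |z| ≤ M)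
    (hw : |w| ≤ M) : |x * w - y * z| ≤ 2 * M ^ 2 := by
  have hM : 0 ≤ M := (abs_nonneg x).trans hx
  calc |x * w - y * z| ≤ |x| * |w| + |y| * |z| := by
        rw [← abs_mul, ← abs_mul]
        exact abs_sub _ _
    _ ≤ M * M + M * M := by gcongr
    _ = 2 * M ^ 2 := by ring

/-- The difference of two integers of absolute value at most `N` is at most `2N` in absolute
value. -/
theorem abs_sub_le_two_mul {N x y : ℤ} (hx : |x| ≤ N) (hy : |y| ≤ N) : |x - y| ≤ 2 * N := by
  rw [abs_le] at *
  constructor <;> linarith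

/-- The intersection point of two non-parallel lines, each through two integer points
with coordinates bounded by `N`, has both coordinates rational with a common
denominator `D` satisfying `0 < |D| ≤ 8N²`. -/
theorem stmt8 (N : ℕ) (hN : 0 < N) (a b c d : ℤ × ℤ)
    (ha : |a.1| ≤ (N : ℤ) ∧ |a.2| ≤ (N : ℤ))
    (hb : |b.1| ≤ (N : ℤ) ∧ |b.2| ≤ (N : ℤ))
    (hc : |c.1| ≤ (N : ℤ) ∧ |c.2| ≤ (N : ℤ))
    (hd : |d.1| ≤ (N : ℤ) ∧ |d.2| ≤ (N : ℤ))
    (hdet : (b.1 - a.1) * (d.2 - c.2) - (b.2 - a.2) * (d.1 - c.1) ≠ 0)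
    (u : ℝ × ℝ)
    (hu₁ : u ∈ affineSpan ℝ
      ({((a.1 : ℝ), (a.2 : ℝ)), ((b.1 : ℝ), (b.2 : ℝ))} : Set (ℝ × ℝ)))
    (hu₂ : u ∈ affineSpan ℝ
      ({((c.1 : ℝ), (c.2 : ℝ)), ((d.1 : ℝ), (d.2 : ℝ))} : Set (ℝ × ℝ))) :
    ∃ D : ℤ, D ≠ 0 ∧ |D| ≤ 8 * (N : ℤ) ^ 2 ∧
      (∃ m₁ : ℤ, (D : ℝ) * u.1 = (m₁ : ℝ)) ∧ (∃ m₂ : ℤ, (D : ℝ) * u.2 = (m₂ : ℝ)) := by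
  refine ⟨(b.1 - a.1) * (d.2 - c.2) - (b.2 - a.2) * (d.1 - c.1), hdet, ?_, ?_⟩
  · refine (abs_det_two_le (abs_sub_le_two_mul hb.1 ha.1) (abs_sub_le_two_mul hb.2 ha.2)
      (abs_sub_le_two_mul hd.1 hc.1) (abs_sub_le_two_mul hd.2 hc.2)).trans_eq (by ring)
  obtain ⟨t, ht⟩ := mem_affineSpan_pair_iff_exists_lineMap_eq.mp hu₁
  obtain ⟨s, hs⟩ := mem_affineSpan_pair_iff_exists_lineMap_eq.mp hu₂
  obtain ⟨ht₁, ht₂⟩ := Prod.ext_iff.mp ht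
  obtain ⟨hs₁, hs₂⟩ := Prod.ext_iff.mp hs
  simp only [AffineMap.lineMap_apply, vsub_eq_sub, vadd_eq_add, Prod.fst_add, Prod.snd_add,
    Prod.smul_fst, Prod.smul_snd, Prod.fst_sub, Prod.snd_sub, smul_eq_mul] at ht₁ ht₂ hs₁ hs₂
  -- Cramer's rule for the parameter `t` of `u` on the first line
  have key : ((b.1 - a.1) * (d.2 - c.2) - (b.2 - a.2) * (d.1 - c.1) : ℝ) * t =
      (c.1 - a.1) * (d.2 - c.2) - (c.2 - a.2) * (d.1 - c.1) := by
    linear_combination (d.2 - c.2 : ℝ) * (ht₁ - hs₁) - (d.1 - c.1 : ℝ) * (ht₂ - hs₂)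
  refine ⟨⟨((b.1 - a.1) * (d.2 - c.2) - (b.2 - a.2) * (d.1 - c.1)) * a.1 +
      ((c.1 - a.1) * (d.2 - c.2) - (c.2 - a.2) * (d.1 - c.1)) * (b.1 - a.1), ?_⟩,
    ⟨((b.1 - a.1) * (d.2 - c.2) - (b.2 - a.2) * (d.1 - c.1)) * a.2 +
      ((c.1 - a.1) * (d.2 - c.2) - (c.2 - a.2) * (d.1 - c.1)) * (b.2 - a.2), ?_⟩⟩
  · push_cast
    rw [← ht₁]
    linear_combination (b.1 - a.1 : ℝ) * key
  · push_cast
    rw [← ht₂]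
    linear_combination (b.2 - a.2 : ℝ) * key
end
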